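/- There exists a θ-invariant set Ω̃ ∈ ℱ with ℙ(Ω̃) = 1 such that for every ω ∈ Ω̃ the limit Φ(ω) := lim_{n→∞} (φ(n,ω)ᵀ φ(n,ω))^{1/(2n)} exists (in the space of d×d real matrices, where the (1/(2n))-th power is the positive-definite power of the symmetric positive-definite matrix φ(n,ω)ᵀφ(n,ω)) and Φ(ω) is a symmetric positive-definite matrix. -/

import Mathlib

open Matrix Filter Topology MeasureTheory

noncomputable section

/-- The Euclidean norm of a vector in `ℝ^d`. -/
def eNorm {ι : Type*} [Fintype ι] (x : ι → ℝ) : ℝ := Real.sqrt (∑ i, x i ^ 2)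

/-- The operator norm of a matrix, with respect to the Euclidean norm. -/
def opNorm {ι : Type*} [Fintype ι] (M : Matrix ι ι ℝ) : ℝ :=
  ⨆ x : {x : ι → ℝ // eNorm x ≤ 1}, eNorm (M *ᵥ (x : ι → ℝ))

open scoped ENNReal

def mxf {Ω : Type*} (θ : Ω → Ω) (g : Ω → ℝ≥0∞) (l : ℝ≥0∞) : ℕ → Ω → ℝ≥0∞
  | 0 => fun _ => 0
  | N + 1 => fun ω => g ω + mxf θ g l N (θ ω) - l

lemma mxf_mono {Ω : Type*} (θ : Ω → Ω) (g : Ω → ℝ≥0∞) (l : ℝ≥0∞) (N : ℕ) :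
    ∀ ω, mxf θ g l N ω ≤ mxf θ g l (N + 1) ω := by
  induction N with
  | zero => intro ω; simp [mxf]
  | succ N ih =>
    intro ω
    rw [mxf, mxf]
    exact tsub_le_tsub_right (add_le_add_right (ih _) _) _

lemma mxf_sum {Ω : Type*} (θ : Ω → Ω) (g : Ω → ℝ≥0∞) (l : ℝ≥0∞) (N : ℕ) :
    ∀ ω, ∑ j ∈ Finset.range N, g (θ^[j] ω) ≤ mxf θ g l N ω + N * l := by
  induction N with
  | zero => intro ω; simp
  | succ N ih =>
    intro ω
    rw [Finset.sum_range_succ']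
    simp only [Function.iterate_succ_apply, Function.iterate_zero_apply]
    calc _ ≤ (mxf θ g l N (θ ω) + N * l) + g ω := add_le_add_left (ih _) _
      _ = (g ω + mxf θ g l N (θ ω)) + N * l := by ring
      _ ≤ (mxf θ g l (N+1) ω + l) + N * l := by
        refine add_le_add_left ?_ _
        show _ ≤ (g ω + mxf θ g l N (θ ω) - l) + l
        exact le_tsub_add
      _ = _ := by push_cast; ring

lemma mxf_meas {Ω : Type*} [MeasurableSpace Ω] (θ : Ω → Ω) (hθ : Measurable θ) (g : Ω → ℝ≥0∞)
    (hg : Measurable g) (l : ℝ≥0∞) (N : ℕ) : Measurable (mxf θ g l N) := by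
  induction N with
  | zero => exact measurable_const
  | succ N ih =>
    exact (hg.add (ih.comp hθ)).sub_const l

lemma mxf_int {Ω : Type*} [MeasurableSpace Ω] {μ : Measure Ω} (θ : Ω → Ω)
    (hθ : MeasurePreserving θ μ μ) (g : Ω → ℝ≥0∞)
    (hg : Measurable g) (hgi : ∫⁻ ω, g ω ∂μ ≠ ∞) (l : ℝ≥0∞) (N : ℕ) :
    ∫⁻ ω, mxf θ g l N ω ∂μ ≠ ∞ := by
  induction N with
  | zero => simp [mxf]
  | succ N ih =>
    have : ∫⁻ ω, mxf θ g l (N+1) ω ∂μ ≤ ∫⁻ ω, g ω ∂μ + ∫⁻ ω, mxf θ g l N ω ∂μ := by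
      rw [← hθ.lintegral_comp (mxf_meas θ hθ.measurable g hg l N), ← lintegral_add_left hg]
      exact lintegral_mono fun ω => tsub_le_self
    exact ne_top_of_le_ne_top (ENNReal.add_ne_top.2 ⟨hgi, ih⟩) this

lemma maximal_ineq {Ω : Type*} [MeasurableSpace Ω] {μ : Measure Ω} (θ : Ω → Ω)
    (hθ : MeasurePreserving θ μ μ) (g : Ω → ℝ≥0∞)
    (hg : Measurable g) (hgi : ∫⁻ ω, g ω ∂μ ≠ ∞) (l : ℝ≥0∞) :
    l * μ {ω | ∃ n : ℕ, n * l < ∑ j ∈ Finset.range n, g (θ^[j] ω)} ≤ ∫⁻ ω, g ω ∂μ := by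
  have hm := mxf_meas θ hθ.measurable g hg l
  have key : ∀ N, l * μ {ω | 0 < mxf θ g l N ω} ≤ ∫⁻ ω, g ω ∂μ := by
    intro N
    cases N with
    | zero => simp [mxf]
    | succ N =>
      have hms : MeasurableSet {ω | 0 < mxf θ g l (N+1) ω} :=
        measurableSet_lt measurable_const (hm _)
      have h1 : ∫⁻ ω, mxf θ g l (N+1) ω ∂μ + l * μ {ω | 0 < mxf θ g l (N+1) ω}
          ≤ ∫⁻ ω, mxf θ g l (N+1) ω ∂μ + ∫⁻ ω, g ω ∂μ := by
        calc _ = ∫⁻ ω, (mxf θ g l (N+1) ω +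
                Set.indicator {ω | 0 < mxf θ g l (N+1) ω} (fun _ => l) ω) ∂μ := by
              rw [lintegral_add_left (hm _), lintegral_indicator_const hms]
          _ ≤ ∫⁻ ω, (mxf θ g l (N+1) (θ ω) + g ω) ∂μ := by
              apply lintegral_mono
              intro ω
              by_cases h : 0 < mxf θ g l (N+1) ω
              · simp only [Set.indicator, Set.mem_ofPred_eq, h, if_true]
                have h2 : l ≤ g ω + mxf θ g l N (θ ω) := by
                  rw [mxf] at h
                  exact (tsub_pos_iff_lt.1 h).le
                rw [mxf, tsub_add_cancel_of_le h2, add_comm]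
                exact add_le_add_left (mxf_mono θ g l N _) _
              · simp only [Set.indicator, Set.mem_ofPred_eq, h, if_false]
                have : mxf θ g l (N+1) ω = 0 := by simpa using h
                simp [this]
          _ = _ := by
              rw [lintegral_add_right _ hg, hθ.lintegral_comp (hm _)]
      exact (ENNReal.add_le_add_iff_left (mxf_int θ hθ g hg hgi l _)).1 h1
  have hsub : {ω | ∃ n : ℕ, n * l < ∑ j ∈ Finset.range n, g (θ^[j] ω)} ⊆
      ⋃ N, {ω | 0 < mxf θ g l N ω} := by
    rintro ω ⟨n, hn⟩
    simp only [Set.mem_iUnion, Set.mem_ofPred_eq]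
    refine ⟨n, ?_⟩
    by_contra h
    have h0 : mxf θ g l n ω = 0 := by simpa using h
    have := mxf_sum θ g l n ω
    rw [h0, zero_add] at this
    exact absurd hn (not_lt.2 this)
  have hmono : Monotone fun N => {ω | 0 < mxf θ g l N ω} :=
    monotone_nat_of_le_succ fun N ω h => lt_of_lt_of_le h (mxf_mono θ g l N ω)
  calc _ ≤ l * μ (⋃ N, {ω | 0 < mxf θ g l N ω}) := by gcongr
    _ = ⨆ N, l * μ {ω | 0 < mxf θ g l N ω} := by
      rw [hmono.measure_iUnion, ENNReal.mul_iSup]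
    _ ≤ _ := iSup_le key

lemma block_bound (x : ℕ → ℕ → ℝ≥0∞) (hsub : ∀ i m n, x i (m + n) ≤ x i m + x (i + m) n)
    (N : ℕ) (hN : 1 ≤ N) (g : ℕ → ℝ≥0∞) (c : ℝ≥0∞)
    (hgood : ∀ i, x i 1 ≤ g i ∨ ∃ k : ℕ, 1 ≤ k ∧ k ≤ N ∧ x i k ≤ k * c) :
    ∀ n, 1 ≤ n → ∀ i, x i n ≤ n * c + ∑ j ∈ Finset.Ico i (i + n), g j +
      ∑ j ∈ Finset.Ico (i + (n - N)) (i + n), x j 1 := by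
  have hs : ∀ n, 1 ≤ n → ∀ i, x i n ≤ ∑ j ∈ Finset.Ico i (i + n), x j 1 := by
    intro n hn
    induction n, hn using Nat.le_induction with
    | base => intro i; simp
    | succ n hn ih =>
      intro i
      rw [← add_assoc, Finset.sum_Ico_succ_top (by omega)]
      exact (hsub i n 1).trans (add_le_add_left (ih i) _)
  intro n
  induction n using Nat.strong_induction_on with
  | _ n ih =>
    intro hn i
    by_cases hnN : n ≤ N
    · rw [Nat.sub_eq_zero_of_le hnN, add_zero]
      exact (hs n hn i).trans le_add_self
    · push Not at hnN
      have main : ∀ k, 1 ≤ k → k ≤ N → x i k ≤ k * c + ∑ j ∈ Finset.Ico i (i + k), g j →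
          x i n ≤ n * c + ∑ j ∈ Finset.Ico i (i + n), g j +
            ∑ j ∈ Finset.Ico (i + (n - N)) (i + n), x j 1 := by
        intro k hk hkN hx
        obtain ⟨r, rfl⟩ : ∃ r, n = k + r := ⟨n - k, by omega⟩
        have h := ih r (by omega) (by omega) (i + k)
        have e1 : ∑ j ∈ Finset.Ico i (i + (k + r)), g j = ∑ j ∈ Finset.Ico i (i + k), g j
            + ∑ j ∈ Finset.Ico (i + k) (i + k + r), g j := by
          rw [← add_assoc, Finset.sum_Ico_consecutive] <;> omega
        have e2 : ∑ j ∈ Finset.Ico (i + k + (r - N)) (i + k + r), x j 1 ≤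
            ∑ j ∈ Finset.Ico (i + (k + r - N)) (i + (k + r)), x j 1 := by
          apply Finset.sum_le_sum_of_subset
          apply Finset.Ico_subset_Ico <;> omega
        calc x i (k + r) ≤ x i k + x (i + k) r := hsub _ _ _
          _ ≤ (k * c + ∑ j ∈ Finset.Ico i (i + k), g j) + _ := add_le_add hx h
          _ ≤ (k * c + ∑ j ∈ Finset.Ico i (i + k), g j) + (r * c + 
            ∑ j ∈ Finset.Ico (i + k) (i + k + r), g j +
            ∑ j ∈ Finset.Ico (i + (k + r - N)) (i + (k + r)), x j 1) := by gcongr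
          _ = _ := by rw [e1]; push_cast; ring
      rcases hgood i with h | ⟨k, hk, hkN, h⟩
      · apply main 1 le_rfl hN
        simpa using h.trans le_add_self
      · exact main k hk hkN (h.trans le_self_add)

lemma block_bound' (x : ℕ → ℕ → ℝ≥0∞) (hsub : ∀ i m n, x i (m + n) ≤ x i m + x (i + m) n)
    (N : ℕ) (hN : 1 ≤ N) (g : ℕ → ℝ≥0∞) (c : ℝ≥0∞)
    (hgood : ∀ i, x i 1 ≤ g i ∨ ∃ k : ℕ, 1 ≤ k ∧ k ≤ N ∧ x i k ≤ k * c)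
    (hK : ∀ i, x i 1 ≤ N + g i) (n : ℕ) (hn : 1 ≤ n) :
    x 0 n ≤ n * c + 2 * ∑ j ∈ Finset.range n, g j + N * N := by
  have h := block_bound x hsub N hN g c hgood n hn 0
  simp only [zero_add] at h
  have e2 : ∑ j ∈ Finset.Ico (n - N) n, x j 1 ≤ N * N + ∑ j ∈ Finset.range n, g j := by
    calc _ ≤ ∑ j ∈ Finset.Ico (n - N) n, ((N : ℝ≥0∞) + g j) := Finset.sum_le_sum fun j _ => hK j
      _ = ((n - (n - N) : ℕ) : ℝ≥0∞) * N + ∑ j ∈ Finset.Ico (n - N) n, g j := by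
        rw [Finset.sum_add_distrib]; simp
      _ ≤ _ := by
        gcongr
        · omega
        · intro a ha
          simp at ha ⊢; exact ha.2
  calc _ ≤ _ := h
    _ ≤ n * c + ∑ j ∈ Finset.range n, g j + (N * N + ∑ j ∈ Finset.range n, g j) := by
      rw [← Finset.range_eq_Ico]
      gcongr
    _ = _ := by ring

lemma liminf_inv_aux {Ω : Type*} (θ : Ω → Ω) (f : ℕ → Ω → ℝ≥0∞)
    (hsub : ∀ m n ω, f (m + n) ω ≤ f m ω + f n (θ^[m] ω)) (ω : Ω) (hω : f 1 ω ≠ ∞) :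
    liminf (fun n : ℕ => f n ω / n) atTop ≤ liminf (fun n : ℕ => f n (θ ω) / n) atTop := by
  apply ENNReal.le_of_forall_pos_le_add
  intro ε hε _
  rw [← liminf_add_const _ _ _ (by isBoundedDefault) (by isBoundedDefault)]
  rw [← liminf_nat_add _ 1]
  apply liminf_le_liminf _ (by isBoundedDefault) (by isBoundedDefault)
  have ht : Tendsto (fun n : ℕ => f 1 ω / (n : ℝ≥0∞)) atTop (𝓝 0) :=
    ENNReal.Tendsto.const_div ENNReal.tendsto_nat_nhds_top (Or.inr hω) |>.trans (by simp)
  have hev := ht.eventually_lt_const (show (0 : ℝ≥0∞) < ε by exact_mod_cast hε)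
  filter_upwards [hev] with n hn
  have h1 : f (n + 1) ω ≤ f 1 ω + f n (θ ω) := by
    have := hsub 1 n ω
    rwa [add_comm 1 n] at this
  calc f (n + 1) ω / ((n + 1 : ℕ) : ℝ≥0∞) ≤ (f 1 ω + f n (θ ω)) / n := by
        gcongr; simp
    _ = f n (θ ω) / n + f 1 ω / n := by rw [ENNReal.add_div, add_comm]
    _ ≤ _ := by gcongr

theorem kingman_enn {Ω : Type*} [MeasurableSpace Ω] {μ : Measure Ω} [IsProbabilityMeasure μ]
    (θ : Ω → Ω) (hθ : MeasurePreserving θ μ μ) (f : ℕ → Ω → ℝ≥0∞) (hf : ∀ n, Measurable (f n))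
    (hsub : ∀ m n ω, f (m + n) ω ≤ f m ω + f n (θ^[m] ω)) (h1 : ∫⁻ ω, f 1 ω ∂μ ≠ ∞) :
    ∀ᵐ ω ∂μ, ∃ L : ℝ≥0∞, L ≠ ∞ ∧ Tendsto (fun n : ℕ => f n ω / n) atTop (𝓝 L) := by
  set F : Ω → ℝ≥0∞ := fun ω => liminf (fun n : ℕ => f n ω / n) atTop with hF
  have hFm : Measurable F := Measurable.liminf fun n => (hf n).div_const _
  have hfin1 : ∀ᵐ ω ∂μ, f 1 ω ≠ ∞ := (ae_lt_top (hf 1) h1).mono fun ω h => h.ne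
  -- integral bound
  have hint : ∀ n : ℕ, 1 ≤ n → ∫⁻ ω, f n ω ∂μ ≤ n * ∫⁻ ω, f 1 ω ∂μ := by
    intro n hn
    induction n, hn using Nat.le_induction with
    | base => simp
    | succ n hn ih =>
      calc ∫⁻ ω, f (n + 1) ω ∂μ ≤ ∫⁻ ω, (f n ω + f 1 (θ^[n] ω)) ∂μ :=
            lintegral_mono fun ω => hsub n 1 ω
        _ = ∫⁻ ω, f n ω ∂μ + ∫⁻ ω, f 1 ω ∂μ := by
            rw [lintegral_add_left (hf n), (hθ.iterate n).lintegral_comp (hf 1)]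
        _ ≤ n * ∫⁻ ω, f 1 ω ∂μ + ∫⁻ ω, f 1 ω ∂μ := by gcongr
        _ = _ := by push_cast; ring
  have hFint : ∫⁻ ω, F ω ∂μ ≠ ∞ := by
    have : ∫⁻ ω, F ω ∂μ ≤ ∫⁻ ω, f 1 ω ∂μ := by
      calc _ ≤ liminf (fun n : ℕ => ∫⁻ ω, f n ω / n ∂μ) atTop :=
            lintegral_liminf_le fun n => (hf n).div_const _
        _ ≤ liminf (fun n : ℕ => ∫⁻ ω, f 1 ω ∂μ) atTop := by
            apply liminf_le_liminf _ (by isBoundedDefault) (by isBoundedDefault)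
            filter_upwards [eventually_ge_atTop 1] with n hn
            simp_rw [div_eq_mul_inv]
            rw [lintegral_mul_const _ (hf n), ← div_eq_mul_inv]
            apply ENNReal.div_le_of_le_mul
            rw [mul_comm]
            exact hint n hn
        _ = _ := by simp
    exact ne_top_of_le_ne_top h1 this
  have hFfin : ∀ᵐ ω ∂μ, F ω ≠ ∞ := (ae_lt_top hFm hFint).mono fun ω h => h.ne
  have hinv : ∀ᵐ ω ∂μ, F ω = F (θ ω) := by
    apply ae_eq_of_ae_le_of_lintegral_le _ hFint (hFm.comp hθ.measurable).aemeasurable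
    · exact (hθ.lintegral_comp hFm).le
    · filter_upwards [hfin1] with ω hω
      exact liminf_inv_aux θ f hsub ω hω
  have hinv' : ∀ᵐ ω ∂μ, ∀ j, F (θ^[j] ω) = F ω := by
    have h : ∀ᵐ ω ∂μ, ∀ j : ℕ, F (θ^[j] ω) = F (θ (θ^[j] ω)) :=
      ae_all_iff.2 fun j => (hθ.iterate j).quasiMeasurePreserving.ae hinv
    filter_upwards [h] with ω hω j
    induction j with
    | zero => rfl
    | succ j ih => rw [Function.iterate_succ_apply', ← hω j, ih]
  -- main estimate
  have key : ∀ ε : ℝ≥0∞, 0 < ε → ε ≠ ∞ → ∀ᵐ ω ∂μ,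
      limsup (fun n : ℕ => f n ω / n) atTop ≤ F ω + ε + 2 * ε := by
    intro ε hε hεt
    let B : ℕ → Set Ω := fun N =>
      {ω | ∀ k : ℕ, 1 ≤ k → k ≤ N → k * (F ω + ε) < f k ω} ∪ {ω | (N : ℝ≥0∞) < f 1 ω}
    have hB : ∀ N, MeasurableSet (B N) := by
      intro N
      apply MeasurableSet.union
      · have : {ω | ∀ k : ℕ, 1 ≤ k → k ≤ N → k * (F ω + ε) < f k ω} =
            ⋂ k : ℕ, ⋂ _ : 1 ≤ k, ⋂ _ : k ≤ N, {ω | k * (F ω + ε) < f k ω} := by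
          ext ω; simp
        rw [this]
        refine MeasurableSet.iInter fun k => MeasurableSet.iInter fun _ =>
          MeasurableSet.iInter fun _ => measurableSet_lt ?_ (hf k)
        exact (hFm.add_const ε).const_mul _
      · exact measurableSet_lt measurable_const (hf 1)
    let g : ℕ → Ω → ℝ≥0∞ := fun N => (B N).indicator (f 1)
    have hg : ∀ N, Measurable (g N) := fun N => (hf 1).indicator (hB N)
    have hg_le : ∀ N ω, g N ω ≤ f 1 ω := fun N ω => Set.indicator_le_self _ _ _
    have hgint : ∀ N, ∫⁻ ω, g N ω ∂μ ≠ ∞ := fun N =>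
      ne_top_of_le_ne_top h1 (lintegral_mono (hg_le N))
    have hglim : Tendsto (fun N => ∫⁻ ω, g N ω ∂μ) atTop (𝓝 0) := by
      have : Tendsto (fun N => ∫⁻ ω, g N ω ∂μ) atTop (𝓝 (∫⁻ _, 0 ∂μ)) := by
        apply tendsto_lintegral_of_dominated_convergence (f 1) hg
          (fun N => Eventually.of_forall (hg_le N)) h1
        filter_upwards [hfin1, hFfin] with ω hω1 hωF
        have hfr : ∃ᶠ n : ℕ in atTop, f n ω / n < F ω + ε := by
          apply frequently_lt_of_liminf_lt (by isBoundedDefault)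
          exact ENNReal.lt_add_right hωF hε.ne'
        obtain ⟨k, hk, hk1⟩ := (hfr.and_eventually (eventually_ge_atTop 1)).exists
        obtain ⟨M, hM⟩ := ENNReal.exists_nat_gt hω1
        apply tendsto_const_nhds.congr'
        filter_upwards [eventually_ge_atTop k, eventually_ge_atTop M] with N hNk hNM
        symm
        apply Set.indicator_of_notMem
        rintro (h | h)
        · have h2 := h k hk1 hNk
          have h3 : f k ω < (F ω + ε) * k := by
            rwa [ENNReal.div_lt_iff (Or.inl (by positivity)) (Or.inl (by simp))] at hk
          rw [mul_comm] at h3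
          exact absurd h2 (not_lt.2 h3.le)
        · have h2 : (N : ℝ≥0∞) < f 1 ω := h
          have h3 : (M : ℝ≥0∞) ≤ N := by exact_mod_cast hNM
          exact absurd (hM.trans_le h3) (not_lt.2 h2.le)
      simpa using this
    -- the bad set
    have hdet : ∀ N : ℕ, 1 ≤ N → ∀ ω, (∀ j, F (θ^[j] ω) = F ω) → 
        ¬ (∃ n : ℕ, n * ε < ∑ j ∈ Finset.range n, g N (θ^[j] ω)) →
        limsup (fun n : ℕ => f n ω / n) atTop ≤ F ω + ε + 2 * ε := by
      intro N hN ω hω hbad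
      push Not at hbad
      have hb : ∀ n : ℕ, 1 ≤ n → f n ω ≤ n * (F ω + ε) + 2 * (n * ε) + N * N := by
        intro n hn
        have := block_bound' (fun i n => f n (θ^[i] ω)) (fun i m n => by
            have := hsub m n (θ^[i] ω)
            rw [← Function.iterate_add_apply, add_comm m i] at this
            exact this) N hN (fun j => g N (θ^[j] ω)) (F ω + ε) (fun i => by
            by_cases h : θ^[i] ω ∈ B N
            · left; simp [g, h]
            · right
              have h' : ¬ ∀ k : ℕ, 1 ≤ k → k ≤ N → k * (F (θ^[i] ω) + ε) < f k (θ^[i] ω) :=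
                fun hh => h (Or.inl hh)
              push Not at h'
              rw [hω i] at h'
              exact h') (fun i => by
            by_cases h : θ^[i] ω ∈ B N
            · simp [g, h]
            · have h' : ¬ ((N : ℝ≥0∞) < f 1 (θ^[i] ω)) := fun hh => h (Or.inr hh)
              exact (not_lt.1 h').trans le_self_add) n hn
        refine this.trans ?_
        gcongr
        exact hbad n
      have ht : Tendsto (fun n : ℕ => (N * N : ℝ≥0∞) / (n : ℝ≥0∞)) atTop (𝓝 0) :=
        ENNReal.Tendsto.const_div ENNReal.tendsto_nat_nhds_top
          (Or.inr (ENNReal.mul_ne_top (by simp) (by simp))) |>.trans (by simp)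
      have ht2 : Tendsto (fun n : ℕ => (F ω + ε + 2 * ε) + (N * N : ℝ≥0∞) / (n : ℝ≥0∞)) atTop
          (𝓝 (F ω + ε + 2 * ε)) := by
        simpa using tendsto_const_nhds.add ht
      rw [← ht2.limsup_eq]
      apply limsup_le_limsup _ (by isBoundedDefault) (by isBoundedDefault)
      filter_upwards [eventually_ge_atTop 1] with n hn
      have hn0 : (n : ℝ≥0∞) ≠ 0 := by positivity
      have hnt : (n : ℝ≥0∞) ≠ ∞ := by simp
      apply ENNReal.div_le_of_le_mul
      refine (hb n hn).trans (le_of_eq ?_)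
      rw [add_mul, ENNReal.div_mul_cancel hn0 hnt]
      ring
    have hnull : μ {ω | (∀ j, F (θ^[j] ω) = F ω) ∧ 
        ¬ limsup (fun n : ℕ => f n ω / n) atTop ≤ F ω + ε + 2 * ε} = 0 := by
      set Z := {ω | (∀ j, F (θ^[j] ω) = F ω) ∧ 
        ¬ limsup (fun n : ℕ => f n ω / n) atTop ≤ F ω + ε + 2 * ε}
      have hle : ∀ N : ℕ, 1 ≤ N → ε * μ Z ≤ ∫⁻ ω, g N ω ∂μ := by
        intro N hN
        refine le_trans ?_ (maximal_ineq θ hθ (g N) (hg N) (hgint N) ε)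
        gcongr
        rintro ω ⟨hω1, hω2⟩
        by_contra hc
        exact hω2 (hdet N hN ω hω1 hc)
      have : ε * μ Z ≤ 0 := ge_of_tendsto hglim
        ((eventually_ge_atTop 1).mono hle)
      simpa [hε.ne'] using this
    have hae : ∀ᵐ ω ∂μ, ¬ ((∀ j, F (θ^[j] ω) = F ω) ∧ 
        ¬ limsup (fun n : ℕ => f n ω / n) atTop ≤ F ω + ε + 2 * ε) := by
      rw [ae_iff]; simpa using hnull
    filter_upwards [hae, hinv'] with ω h1 h2
    by_contra hc
    exact h1 ⟨h2, hc⟩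
  have key2 : ∀ᵐ ω ∂μ, ∀ m : ℕ, limsup (fun n : ℕ => f n ω / n) atTop ≤
      F ω + (m + 1 : ℝ≥0∞)⁻¹ + 2 * (m + 1 : ℝ≥0∞)⁻¹ := by
    rw [ae_all_iff]
    intro m
    exact key _ (ENNReal.inv_pos.2 (by finiteness)) (ENNReal.inv_ne_top.2 (by positivity))
  filter_upwards [key2, hFfin] with ω hω hωF
  refine ⟨F ω, hωF, tendsto_of_le_liminf_of_limsup_le le_rfl ?_⟩
  have ht : Tendsto (fun m : ℕ => ((m : ℝ≥0∞) + 1)⁻¹) atTop (𝓝 0) := by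
    have := (ENNReal.tendsto_inv_nat_nhds_zero).comp (tendsto_add_atTop_nat 1)
    refine this.congr fun n => by simp
  have ht2 : Tendsto (fun m : ℕ => F ω + (m + 1 : ℝ≥0∞)⁻¹ + 2 * (m + 1 : ℝ≥0∞)⁻¹) atTop
      (𝓝 (F ω + 0 + 2 * 0)) :=
    (tendsto_const_nhds.add ht).add (ENNReal.Tendsto.const_mul ht (Or.inr (by simp)))
  simp only [add_zero, mul_zero] at ht2
  exact ge_of_tendsto' ht2 hω

theorem kingman_real {Ω : Type*} [MeasurableSpace Ω] {μ : Measure Ω} [IsProbabilityMeasure μ]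
    (θ : Ω → Ω) (hθ : MeasurePreserving θ μ μ) (f : ℕ → Ω → ℝ) (hf : ∀ n, Measurable (f n))
    (hsub : ∀ m n ω, f (m + n) ω ≤ f m ω + f n (θ^[m] ω))
    (h1 : ∫⁻ ω, ENNReal.ofReal (f 1 ω) ∂μ ≠ ∞) 
    (hpos : ∀ᵐ ω ∂μ, ∀ n, 1 ≤ n → 0 ≤ f n ω) :
    ∀ᵐ ω ∂μ, ∃ L : ℝ, Tendsto (fun n : ℕ => f n ω / n) atTop (𝓝 L) := by
  have := kingman_enn (μ := μ) θ hθ (fun n ω => ENNReal.ofReal (f n ω))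
    (fun n => (hf n).ennreal_ofReal) (fun m n ω =>
      (ENNReal.ofReal_le_ofReal (hsub m n ω)).trans ENNReal.ofReal_add_le) h1
  filter_upwards [this, hpos] with ω ⟨L, hL, hT⟩ hp
  refine ⟨L.toReal, ((ENNReal.tendsto_toReal hL).comp hT).congr' ?_⟩
  filter_upwards [eventually_ge_atTop 1] with n hn
  simp [ENNReal.toReal_div, ENNReal.toReal_ofReal (hp n hn)]

structure SVData {d : ℕ} (M u : Matrix (Fin d) (Fin d) ℝ) (s : Fin d → ℝ) : Prop where
  orth : u * uᵀ = 1
  pos : ∀ i, 0 < s i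
  anti : Antitone s
  eq : Mᵀ * M = uᵀ * diagonal (fun i => s i ^ 2) * u

lemma exists_SVData {d : ℕ} (M : Matrix (Fin d) (Fin d) ℝ) (hM : IsUnit M.det) :
    ∃ u s, SVData M u s := by
  have hP : (Mᵀ * M).PosDef := by
    have := Matrix.PosDef.conjTranspose_mul_self M
      (Matrix.mulVec_injective_iff_isUnit.2 ((Matrix.isUnit_iff_isUnit_det M).2 hM))
    simpa using this
  have hH := hP.isHermitian
  let V : Matrix (Fin d) (Fin d) ℝ := hH.eigenvectorUnitary
  have hV : V * Vᵀ = 1 := by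
    have := hH.eigenvectorUnitary.2
    have := (Matrix.mem_unitaryGroup_iff).1 this
    simpa [star_eq_conjTranspose] using this
  have hV' : Vᵀ * V = 1 := mul_eq_one_comm.1 hV
  have hspec : Mᵀ * M = V * diagonal hH.eigenvalues * Vᵀ := by
    have := hH.spectral_theorem
    rw [Unitary.conjStarAlgAut_apply] at this
    simpa [star_eq_conjTranspose, Function.comp_def] using this
  let π := Tuple.sort (fun i => - hH.eigenvalues i)
  have hπ : Monotone ((fun i => - hH.eigenvalues i) ∘ π) := Tuple.monotone_sort _
  have hpos := hP.eigenvalues_pos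
  refine ⟨Vᵀ.submatrix π id, fun i => Real.sqrt (hH.eigenvalues (π i)), ?_, ?_, ?_, ?_⟩
  · rw [Matrix.transpose_submatrix, Matrix.transpose_transpose]
    have e : Vᵀ.submatrix π id * V.submatrix id π = (Vᵀ * V).submatrix π π := rfl
    rw [e, hV']
    simp
  · intro i
    exact Real.sqrt_pos.2 (hpos _)
  · intro i j hij
    apply Real.sqrt_le_sqrt
    have := hπ hij
    simpa using this
  · have h1 : (diagonal fun i => Real.sqrt (hH.eigenvalues (π i)) ^ 2) =
        (diagonal hH.eigenvalues).submatrix π π := by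
      rw [Matrix.submatrix_diagonal_equiv]
      congr 1; ext i
      simp [Real.sq_sqrt (hpos _).le]
    rw [h1, Matrix.transpose_submatrix, Matrix.transpose_transpose]
    refine hspec.trans ?_
    rw [Matrix.submatrix_mul_equiv, Matrix.submatrix_mul_equiv]
    simp

namespace SVData
variable {d : ℕ} {M u M' u' : Matrix (Fin d) (Fin d) ℝ} {s s' : Fin d → ℝ}

lemma orth' (h : SVData M u s) : uᵀ * u = 1 := mul_eq_one_comm.1 h.orth

lemma dot_mul (M : Matrix (Fin d) (Fin d) ℝ) (x y : Fin d → ℝ) :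
    (M *ᵥ x) ⬝ᵥ (M *ᵥ y) = x ⬝ᵥ ((Mᵀ * M) *ᵥ y) := by
  rw [← Matrix.mulVec_mulVec, Matrix.dotProduct_mulVec x, Matrix.vecMul_transpose]

lemma quad (h : SVData M u s) (x y : Fin d → ℝ) :
    (M *ᵥ x) ⬝ᵥ (M *ᵥ y) = ∑ i, s i ^ 2 * ((u *ᵥ x) i * (u *ᵥ y) i) := by
  rw [dot_mul, h.eq, ← Matrix.mulVec_mulVec, ← Matrix.mulVec_mulVec,
    Matrix.dotProduct_mulVec x, Matrix.vecMul_transpose]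
  simp only [dotProduct, Matrix.mulVec_diagonal]
  exact Finset.sum_congr rfl fun i _ => by ring

lemma row_dot (h : SVData M u s) (i j : Fin d) : u i ⬝ᵥ u j = if i = j then 1 else 0 := by
  have := congrFun (congrFun h.orth i) j
  rw [Matrix.one_apply] at this
  rw [← this]; rfl

lemma mulVec_row (h : SVData M u s) (j : Fin d) : u *ᵥ (u j) = Pi.single j 1 := by
  ext i
  rw [Matrix.mulVec, h.row_dot, Pi.single_apply]

lemma sv_dot (h : SVData M u s) (i j : Fin d) :
    (M *ᵥ u i) ⬝ᵥ (M *ᵥ u j) = if i = j then s i ^ 2 else 0 := by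
  rw [h.quad, h.mulVec_row, h.mulVec_row]
  by_cases hij : i = j
  · subst hij; simp [Pi.single_apply]
  · simp [Pi.single_apply, hij, Ne.symm hij]

lemma abs_entry (h : SVData M u s) (i j : Fin d) : |u i j| ≤ 1 := by
  have h1 := h.row_dot i i
  simp only [if_true, dotProduct] at h1
  have h2 : u i j * u i j ≤ 1 := by
    rw [← h1]
    exact Finset.single_le_sum (f := fun k => u i k * u i k) (fun k _ => mul_self_nonneg _)
      (Finset.mem_univ j)
  exact abs_le_one_iff_mul_self_le_one.2 h2

lemma cross (h : SVData M u s) (h' : SVData M' u' s') {a : ℝ} (ha : 0 ≤ a)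
    (hM : ∀ x, (M' *ᵥ x) ⬝ᵥ (M' *ᵥ x) ≤ a ^ 2 * ((M *ᵥ x) ⬝ᵥ (M *ᵥ x))) (i j : Fin d) :
    |(u' * uᵀ) i j| ≤ a * s j / s' i := by
  have h1 := hM (u j)
  rw [h.sv_dot, h'.quad, if_pos rfl] at h1
  have h2 : s' i ^ 2 * ((u' *ᵥ u j) i * (u' *ᵥ u j) i) ≤ a ^ 2 * s j ^ 2 := by
    refine le_trans ?_ h1
    exact Finset.single_le_sum (f := fun i => s' i ^ 2 * ((u' *ᵥ u j) i * (u' *ᵥ u j) i))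
      (fun k _ => mul_nonneg (sq_nonneg _) (mul_self_nonneg _)) (Finset.mem_univ i)
  have h3 : (u' *ᵥ u j) i = (u' * uᵀ) i j := rfl
  rw [h3] at h2
  rw [le_div_iff₀ (h'.pos i)]
  apply abs_le_of_sq_le_sq' _ (mul_nonneg ha (h.pos j).le) |>.2
  rw [mul_pow, sq_abs]
  nlinarith

end SVData

lemma summable_exp_of_neg (c : ℕ → ℝ) (κ : ℝ) (hκ : κ < 0)
    (h : Tendsto (fun n : ℕ => c n / n) atTop (𝓝 κ)) : Summable fun n => Real.exp (c n) := by
  have hg : Summable fun n : ℕ => Real.exp (κ / 2) ^ n :=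
    summable_geometric_of_lt_one (Real.exp_pos _).le (Real.exp_lt_one_iff.2 (by linarith))
  apply Summable.of_norm_bounded_eventually_nat hg
  filter_upwards [h.eventually_lt_const (show κ < κ / 2 by linarith),
    eventually_ge_atTop 1] with n hn hn1
  rw [Real.norm_of_nonneg (Real.exp_pos _).le, ← Real.exp_nat_mul]
  apply Real.exp_le_exp.2
  have : (0 : ℝ) < n := by exact_mod_cast hn1
  rw [div_lt_iff₀ this] at hn
  linarith

lemma tendsto_shift_div (c : ℕ → ℝ) (l : ℝ) (h : Tendsto (fun n : ℕ => c n / n) atTop (𝓝 l)) :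
    Tendsto (fun n : ℕ => c (n + 1) / n) atTop (𝓝 l) := by
  have h1 := h.comp (tendsto_add_atTop_nat 1)
  have h2 : Tendsto (fun n : ℕ => ((n : ℝ) + 1) / n) atTop (𝓝 1) := by
    have : Tendsto (fun n : ℕ => 1 + 1 / (n : ℝ)) atTop (𝓝 (1 + 0)) :=
      tendsto_const_nhds.add tendsto_one_div_atTop_nhds_zero_nat
    rw [add_zero] at this
    refine this.congr' ?_
    filter_upwards [eventually_ge_atTop 1] with n hn
    have : (n : ℝ) ≠ 0 := by positivity
    field_simp
  have h3 := h1.mul h2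
  rw [mul_one] at h3
  refine h3.congr' ?_
  filter_upwards [eventually_ge_atTop 1] with n hn
  have : (n : ℝ) ≠ 0 := by positivity
  have h4 : (n : ℝ) + 1 ≠ 0 := by positivity
  simp only [Function.comp, Nat.cast_add, Nat.cast_one]
  field_simp

lemma abs_conj_entry {d : ℕ} {u u' X : Matrix (Fin d) (Fin d) ℝ} (hu : ∀ i j, |u i j| ≤ 1)
    (hu' : ∀ i j, |u' i j| ≤ 1) (a b : Fin d) : |(u'ᵀ * X * u) a b| ≤ ∑ j, ∑ i, |X i j| := by
  rw [Matrix.mul_apply]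
  refine (Finset.abs_sum_le_sum_abs _ _).trans (Finset.sum_le_sum fun j _ => ?_)
  rw [Matrix.mul_apply, abs_mul]
  refine (mul_le_of_le_one_right (abs_nonneg _) (hu _ _)).trans ?_
  refine (Finset.abs_sum_le_sum_abs _ _).trans (Finset.sum_le_sum fun i _ => ?_)
  rw [abs_mul, Matrix.transpose_apply]
  exact mul_le_of_le_one_left (abs_nonneg _) (hu' _ _)

lemma conj_diag_pow {d : ℕ} {u : Matrix (Fin d) (Fin d) ℝ} (hu : u * uᵀ = 1) (D : Fin d → ℝ)
    (m : ℕ) : (uᵀ * diagonal D * u) ^ m = uᵀ * diagonal (D ^ m) * u := by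
  have hu' : uᵀ * u = 1 := mul_eq_one_comm.1 hu
  induction m with
  | zero => simp [hu']
  | succ m ih =>
    rw [pow_succ, ih, pow_succ D, show diagonal (D ^ m * D) = diagonal (D ^ m) * diagonal D from
      (Matrix.diagonal_mul_diagonal _ _).symm]
    simp only [Matrix.mul_assoc]
    rw [← Matrix.mul_assoc u uᵀ, hu, Matrix.one_mul]

lemma conj_diag_symm {d : ℕ} (u : Matrix (Fin d) (Fin d) ℝ) (D : Fin d → ℝ) :
    (uᵀ * diagonal D * u).IsSymm := by
  unfold Matrix.IsSymm
  simp [Matrix.transpose_mul, Matrix.mul_assoc]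

lemma conj_diag_quad {d : ℕ} (u : Matrix (Fin d) (Fin d) ℝ) (D : Fin d → ℝ) (x : Fin d → ℝ) :
    x ⬝ᵥ ((uᵀ * diagonal D * u) *ᵥ x) = ∑ i, D i * ((u *ᵥ x) i * (u *ᵥ x) i) := by
  rw [← Matrix.mulVec_mulVec, ← Matrix.mulVec_mulVec,
    Matrix.dotProduct_mulVec x, Matrix.vecMul_transpose]
  simp only [dotProduct, Matrix.mulVec_diagonal]
  exact Finset.sum_congr rfl fun i _ => by ring

lemma conj_diag_lower {d : ℕ} {u : Matrix (Fin d) (Fin d) ℝ} (hu : u * uᵀ = 1) (D : Fin d → ℝ)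
    (c : ℝ) (hc : ∀ i, c ≤ D i) (x : Fin d → ℝ) :
    c * (x ⬝ᵥ x) ≤ x ⬝ᵥ ((uᵀ * diagonal D * u) *ᵥ x) := by
  have hu' : uᵀ * u = 1 := mul_eq_one_comm.1 hu
  have h1 : x ⬝ᵥ x = ∑ i, (u *ᵥ x) i * (u *ᵥ x) i := by
    have := SVData.dot_mul u x x
    rw [hu', Matrix.one_mulVec] at this
    rw [← this]; rfl
  rw [conj_diag_quad, h1, Finset.mul_sum]
  exact Finset.sum_le_sum fun i _ => mul_le_mul_of_nonneg_right (hc i) (mul_self_nonneg _)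

lemma posDef_of_lower {d : ℕ} {P : Matrix (Fin d) (Fin d) ℝ} (hs : P.IsSymm) {c : ℝ} (hc : 0 < c)
    (h : ∀ x, c * (x ⬝ᵥ x) ≤ x ⬝ᵥ (P *ᵥ x)) : P.PosDef := by
  refine Matrix.PosDef.of_dotProduct_mulVec_pos ?_ ?_
  · rw [Matrix.IsHermitian, Matrix.conjTranspose_eq_transpose_of_trivial]; exact hs
  · intro x hx
    rw [star_trivial]
    refine lt_of_lt_of_le (mul_pos hc ?_) (h x)
    have h0 : 0 ≤ x ⬝ᵥ x := Finset.sum_nonneg fun i _ => mul_self_nonneg _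
    exact lt_of_le_of_ne h0 (fun h => hx (dotProduct_self_eq_zero.1 h.symm))

theorem det_MET {d : ℕ} (T u : ℕ → Matrix (Fin d) (Fin d) ℝ) (s : ℕ → Fin d → ℝ)
    (hsv : ∀ n, SVData (T n) (u n) (s n)) (lam : Fin d → ℝ)
    (hlam : ∀ i, Tendsto (fun n : ℕ => Real.log (s n i) / n) atTop (𝓝 (lam i)))
    (b : ℕ → ℝ) (hb : Tendsto (fun n : ℕ => b n / n) atTop (𝓝 0))
    (h1 : ∀ n x, (T (n+1) *ᵥ x) ⬝ᵥ (T (n+1) *ᵥ x) ≤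
      Real.exp (b n) ^ 2 * ((T n *ᵥ x) ⬝ᵥ (T n *ᵥ x)))
    (h2 : ∀ n x, (T n *ᵥ x) ⬝ᵥ (T n *ᵥ x) ≤
      Real.exp (b n) ^ 2 * ((T (n+1) *ᵥ x) ⬝ᵥ (T (n+1) *ᵥ x))) :
    ∃ Φ : Matrix (Fin d) (Fin d) ℝ, Φ.IsSymm ∧ Φ.PosDef ∧
        ∃ R : ℕ → Matrix (Fin d) (Fin d) ℝ,
          (∀ n : ℕ, 1 ≤ n → (R n).IsSymm ∧ (R n).PosDef ∧
            R n ^ (2 * n) = (T n)ᵀ * T n) ∧ Tendsto R atTop (𝓝 Φ) := by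
  let D : Fin d → ℝ := fun i => Real.exp (lam i)
  let G : ℕ → Matrix (Fin d) (Fin d) ℝ := fun n => (u n)ᵀ * diagonal D * u n
  let r : ℕ → Fin d → ℝ := fun n i => Real.exp (Real.log (s n i) / n)
  let R : ℕ → Matrix (Fin d) (Fin d) ℝ := fun n => (u n)ᵀ * diagonal (r n) * u n
  have hlower : ∀ D : Fin d → ℝ, (∀ i, 0 < D i) → ∃ c, 0 < c ∧ ∀ i, c ≤ D i := by
    intro D hD
    rcases isEmpty_or_nonempty (Fin d) with he | he
    · exact ⟨1, one_pos, fun i => he.elim i⟩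
    · obtain ⟨i, hi⟩ := Finite.exists_min D
      exact ⟨D i, hD i, hi⟩
  -- summability of the off-diagonal terms
  have hW : ∀ i j, Summable fun n => |(D i - D j) * ((u (n+1)) * (u n)ᵀ) i j| := by
    intro i j
    have hl1 : ∀ i, Tendsto (fun n : ℕ => Real.log (s (n+1) i) / n) atTop (𝓝 (lam i)) := fun i =>
      tendsto_shift_div (fun n => Real.log (s n i)) _ (hlam i)
    have hdiv : ∀ n (p q : Fin d), ∀ m, Real.exp (b n) * s n p / s m q =
        Real.exp (b n + Real.log (s n p) - Real.log (s m q)) := by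
      intro n p q m
      rw [Real.exp_sub, Real.exp_add, Real.exp_log ((hsv _).pos _), Real.exp_log ((hsv _).pos _)]
    have hdiv' : ∀ n (p q : Fin d), ∀ m, Real.exp (b n) * s m p / s n q =
        Real.exp (b n + Real.log (s m p) - Real.log (s n q)) := by
      intro n p q m
      rw [Real.exp_sub, Real.exp_add, Real.exp_log ((hsv _).pos _), Real.exp_log ((hsv _).pos _)]
    simp_rw [abs_mul]
    rcases lt_trichotomy (lam i) (lam j) with h | h | h
    · apply Summable.mul_left
      have hsum : Summable fun n : ℕ =>
          Real.exp (b n + Real.log (s (n+1) i) - Real.log (s n j)) := by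
        apply summable_exp_of_neg _ (0 + lam i - lam j) (by linarith)
        refine ((hb.add (hl1 i)).sub (hlam j)).congr fun n => ?_
        ring
      refine Summable.of_nonneg_of_le (fun n => abs_nonneg _) (fun n => ?_) hsum
      have hc := (hsv (n+1)).cross (hsv n) (Real.exp_pos _).le (h2 n) j i
      rw [hdiv'] at hc
      refine le_trans (le_of_eq ?_) hc
      rw [← Matrix.transpose_apply (u n * _), Matrix.transpose_mul, Matrix.transpose_transpose]
    · simp [D, h, summable_zero]
    · apply Summable.mul_left
      have hsum : Summable fun n : ℕ =>
          Real.exp (b n + Real.log (s n j) - Real.log (s (n+1) i)) := by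
        apply summable_exp_of_neg _ (0 + lam j - lam i) (by linarith)
        refine ((hb.add (hlam j)).sub (hl1 i)).congr fun n => ?_
        ring
      refine Summable.of_nonneg_of_le (fun n => abs_nonneg _) (fun n => ?_) hsum
      have hc := (hsv n).cross (hsv (n+1)) (Real.exp_pos _).le (h1 n) i j
      rwa [hdiv] at hc
  have hGdiff : ∀ n, G (n+1) - G n = (u (n+1))ᵀ *
      (Matrix.of fun i j => (D i - D j) * ((u (n+1)) * (u n)ᵀ) i j) * u n := by
    intro n
    have e : (Matrix.of fun i j => (D i - D j) * ((u (n+1)) * (u n)ᵀ) i j) =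
        diagonal D * ((u (n+1)) * (u n)ᵀ) - ((u (n+1)) * (u n)ᵀ) * diagonal D := by
      ext i j
      simp only [Matrix.of_apply, Matrix.sub_apply, Matrix.diagonal_mul, Matrix.mul_diagonal]
      ring
    rw [e, Matrix.mul_sub, Matrix.sub_mul]
    simp only [G]
    congr 1
    · simp only [Matrix.mul_assoc]
      rw [(hsv n).orth', Matrix.mul_one]
    · simp only [← Matrix.mul_assoc]
      rw [(hsv (n+1)).orth', Matrix.one_mul]
  have hGconv : ∀ a c, ∃ L, Tendsto (fun n => G n a c) atTop (𝓝 L) := by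
    intro a c
    apply cauchySeq_tendsto_of_complete
    apply cauchySeq_of_summable_dist
    refine Summable.of_nonneg_of_le (fun n => dist_nonneg) (fun n => ?_)
      (summable_sum fun j (_ : j ∈ Finset.univ) => summable_sum
        fun i (_ : i ∈ Finset.univ) => hW i j)
    rw [dist_comm, Real.dist_eq, ← Matrix.sub_apply, hGdiff]
    exact abs_conj_entry (hsv n).abs_entry (hsv (n+1)).abs_entry a c
  choose Φ hΦ using hGconv
  have hGΦ : Tendsto G atTop (𝓝 (Matrix.of Φ)) := by
    refine tendsto_pi_nhds.2 fun a => tendsto_pi_nhds.2 fun c => hΦ a c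
  have hRG : Tendsto (fun n => R n - G n) atTop (𝓝 0) := by
    refine tendsto_pi_nhds.2 fun a => tendsto_pi_nhds.2 fun c => ?_
    have hz : Tendsto (fun n => ∑ j, ∑ i, |(diagonal (r n) - diagonal D) i j|) atTop
        (𝓝 (∑ j : Fin d, ∑ i : Fin d, 0)) := by
      refine tendsto_finsetSum _ fun j _ => tendsto_finsetSum _ fun i _ => ?_
      by_cases hij : i = j
      · subst hij
        simp only [Matrix.sub_apply, Matrix.diagonal_apply_eq]
        have : Tendsto (fun n => r n i) atTop (𝓝 (D i)) :=
          (Real.continuous_exp.tendsto _).comp (hlam i)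
        have := (this.sub_const (D i)).abs
        simpa using this
      · simp [hij]
    simp only [Finset.sum_const_zero] at hz
    apply squeeze_zero_norm _ hz
    intro n
    have : R n - G n = (u n)ᵀ * (diagonal (r n) - diagonal D) * u n := by
      simp only [R, G, Matrix.mul_sub, Matrix.sub_mul]
    rw [this]
    exact abs_conj_entry (hsv n).abs_entry (hsv n).abs_entry a c
  have hRΦ : Tendsto R atTop (𝓝 (Matrix.of Φ)) := by
    have := hRG.add hGΦ
    simpa using this
  have hΦs : (Matrix.of Φ).IsSymm := by
    unfold Matrix.IsSymm
    have := (continuous_id.matrix_transpose.tendsto (Matrix.of Φ)).comp hGΦ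
    refine tendsto_nhds_unique this ?_
    refine hGΦ.congr fun n => ?_
    exact (conj_diag_symm (u n) D).symm
  refine ⟨Matrix.of Φ, hΦs, ?_, R, fun n hn => ⟨conj_diag_symm _ _, ?_, ?_⟩, hRΦ⟩
  · obtain ⟨c, hc, hcD⟩ := hlower D fun i => Real.exp_pos _
    refine posDef_of_lower hΦs hc fun x => ?_
    have hcont : Continuous fun P : Matrix (Fin d) (Fin d) ℝ => x ⬝ᵥ (P *ᵥ x) :=
      Continuous.dotProduct continuous_const (Continuous.matrix_mulVec continuous_id continuous_const)
    exact ge_of_tendsto' ((hcont.tendsto _).comp hGΦ)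
      fun n => conj_diag_lower (hsv n).orth D c hcD x
  · obtain ⟨c, hc, hcD⟩ := hlower (r n) fun i => Real.exp_pos _
    exact posDef_of_lower (conj_diag_symm _ _) hc (conj_diag_lower (hsv n).orth _ c hcD)
  · rw [(hsv n).eq]
    simp only [R]
    rw [conj_diag_pow (hsv n).orth]
    congr 3
    ext i
    have hn0 : (n : ℝ) ≠ 0 := by positivity
    simp only [Pi.pow_apply, r]
    rw [← Real.exp_nat_mul]
    push_cast
    rw [show 2 * (n : ℝ) * (Real.log (s n i) / n) = 2 * Real.log (s n i) by field_simp]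
    rw [show (2 : ℝ) = ((2 : ℕ) : ℝ) by norm_num, Real.exp_nat_mul, Real.exp_log ((hsv n).pos i)]

def extPull (k : ℕ) {d : ℕ} (M : Matrix (Fin d) (Fin d) ℝ) :
    ((Fin d → ℝ) [⋀^Fin k]→L[ℝ] ℝ) →L[ℝ] ((Fin d → ℝ) [⋀^Fin k]→L[ℝ] ℝ) :=
  ContinuousAlternatingMap.compContinuousLinearMapCLM (LinearMap.toContinuousLinearMap M.mulVecLin)

def extN (k : ℕ) {d : ℕ} (M : Matrix (Fin d) (Fin d) ℝ) : ℝ := ‖extPull k M‖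

lemma extPull_apply (k : ℕ) {d : ℕ} (M : Matrix (Fin d) (Fin d) ℝ)
    (f : (Fin d → ℝ) [⋀^Fin k]→L[ℝ] ℝ) (v : Fin k → Fin d → ℝ) :
    extPull k M f v = f (fun i => M *ᵥ v i) := rfl

lemma extN_mul (k : ℕ) {d : ℕ} (M N : Matrix (Fin d) (Fin d) ℝ) :
    extN k (M * N) ≤ extN k M * extN k N := by
  have : extPull k (M * N) = (extPull k N).comp (extPull k M) := by
    ext f v
    rw [ContinuousLinearMap.comp_apply, extPull_apply, extPull_apply, extPull_apply]
    simp only [Matrix.mulVec_mulVec]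
  unfold extN
  rw [this, mul_comm]
  exact ContinuousLinearMap.opNorm_comp_le _ _

lemma extN_cont (k d : ℕ) : Continuous fun M : Matrix (Fin d) (Fin d) ℝ => extN k M := by
  have hc : Continuous fun M : Matrix (Fin d) (Fin d) ℝ => extPull k M := by
    unfold extPull
    refine Continuous.comp (ContinuousAlternatingMap.continuous_compContinuousLinearMapCLM
      (𝕜 := ℝ) (E := Fin d → ℝ) (F := Fin d → ℝ) (G := ℝ) (ι := Fin k)) ?_
    let L : Matrix (Fin d) (Fin d) ℝ →ₗ[ℝ] ((Fin d → ℝ) →L[ℝ] (Fin d → ℝ)) :=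
      (LinearMap.toContinuousLinearMap (𝕜 := ℝ) (E := Fin d → ℝ)
        (F' := Fin d → ℝ)).toLinearMap.comp (Matrix.mulVecBilin ℝ ℝ)
    exact L.continuous_of_finiteDimensional
  have hn : Continuous fun T : ((Fin d → ℝ) [⋀^Fin k]→L[ℝ] ℝ) →L[ℝ]
      ((Fin d → ℝ) [⋀^Fin k]→L[ℝ] ℝ) => ‖T‖ :=
    @continuous_norm (((Fin d → ℝ) [⋀^Fin k]→L[ℝ] ℝ) →L[ℝ] ((Fin d → ℝ) [⋀^Fin k]→L[ℝ] ℝ)) _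
  exact hn.comp hc

lemma le_strictMono {k d : ℕ} (e : Fin k → Fin d) (he : StrictMono e) (i : Fin k) :
    (i : ℕ) ≤ e i := by
  obtain ⟨i, hi⟩ := i
  induction i with
  | zero => simp
  | succ i ih =>
    have h1 := ih (by omega)
    have h2 : e ⟨i, by omega⟩ < e ⟨i + 1, hi⟩ := he (by simp)
    have h3 : ((e ⟨i, by omega⟩ : Fin d) : ℕ) < e ⟨i + 1, hi⟩ := h2
    simp only at h1 ⊢
    omega

lemma prod_inj_le {k d : ℕ} (hk : k ≤ d) (s : Fin d → ℝ) (hs : Antitone s) (hp : ∀ i, 0 < s i)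
    (J : Fin k → Fin d) (hJ : Function.Injective J) :
    ∏ i, s (J i) ≤ ∏ i : Fin k, s (Fin.castLE hk i) := by
  classical
  let S : Finset (Fin d) := Finset.univ.image J
  have hS : S.card = k := by
    rw [Finset.card_image_of_injective _ hJ]; simp
  have h1 : ∏ i, s (J i) = ∏ a ∈ S, s a := by
    rw [Finset.prod_image fun a _ b _ h => hJ h]
  have h2 : ∏ a ∈ S, s a = ∏ i : Fin k, s (S.orderEmbOfFin hS i) := by
    conv_lhs => rw [← Finset.image_orderEmbOfFin_univ S hS]
    rw [Finset.prod_image fun a _ b _ h => (S.orderEmbOfFin hS).injective h]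
  rw [h1, h2]
  refine Finset.prod_le_prod (fun i _ => (hp _).le) fun i _ => hs ?_
  rw [Fin.le_def]
  exact le_strictMono _ (S.orderEmbOfFin hS).strictMono i

lemma abs_dot_le {d : ℕ} (x v : Fin d → ℝ) (hx : ∀ a, |x a| ≤ 1) : |x ⬝ᵥ v| ≤ d * ‖v‖ := by
  unfold dotProduct
  refine (Finset.abs_sum_le_sum_abs _ _).trans ?_
  calc ∑ i, |x i * v i| ≤ ∑ _i : Fin d, ‖v‖ := by
        refine Finset.sum_le_sum fun i _ => ?_
        rw [abs_mul]
        calc |x i| * |v i| ≤ 1 * |v i| := mul_le_mul_of_nonneg_right (hx i) (abs_nonneg _)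
          _ ≤ ‖v‖ := by rw [one_mul]; exact norm_le_pi_norm v i
    _ = _ := by simp

lemma norm_le_of_dot {d : ℕ} (x : Fin d → ℝ) (c : ℝ) (hc : 0 ≤ c) (h : x ⬝ᵥ x ≤ c ^ 2) :
    ‖x‖ ≤ c := by
  rw [pi_norm_le_iff_of_nonneg hc]
  intro i
  apply abs_le_of_sq_le_sq _ hc
  refine le_trans ?_ h
  rw [sq]
  exact Finset.single_le_sum (f := fun k => x k * x k) (fun k _ => mul_self_nonneg _)
      (Finset.mem_univ i)

lemma extN_upper {k d : ℕ} (hk : k ≤ d) {M u : Matrix (Fin d) (Fin d) ℝ} {s : Fin d → ℝ}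
    (h : SVData M u s) :
    extN k M ≤ ((d : ℝ) ^ k * (d : ℝ) ^ k) * ∏ i : Fin k, s (Fin.castLE hk i) := by
  have hP : 0 ≤ ∏ i : Fin k, s (Fin.castLE hk i) := Finset.prod_nonneg fun i _ => (h.pos _).le
  refine ContinuousLinearMap.opNorm_le_bound _ (by positivity) fun f => ?_
  refine ContinuousAlternatingMap.opNorm_le_bound _ (by positivity) fun v => ?_
  rw [extPull_apply]
  have hv : ∀ i, M *ᵥ v i = ∑ j, (u j ⬝ᵥ v i) • (M *ᵥ u j) := by
    intro i
    have : v i = ∑ j, (u j ⬝ᵥ v i) • u j := by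
      conv_lhs => rw [← Matrix.one_mulVec (v i), ← h.orth', ← Matrix.mulVec_mulVec]
      ext a
      simp [Matrix.mulVec, dotProduct, Finset.sum_apply, mul_comm]
    conv_lhs => rw [this]
    rw [← Matrix.mulVecLin_apply, map_sum]
    simp
  have hMu : ∀ j, ‖M *ᵥ u j‖ ≤ s j := fun j =>
    norm_le_of_dot _ _ (h.pos j).le (by rw [h.sv_dot, if_pos rfl])
  simp_rw [hv]
  have hexp : f (fun i => ∑ j, (u j ⬝ᵥ v i) • (M *ᵥ u j)) =
      ∑ J : Fin k → Fin d, f (fun i => (u (J i) ⬝ᵥ v i) • (M *ᵥ u (J i))) :=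
    f.toMultilinearMap.map_sum fun i j => (u j ⬝ᵥ v i) • (M *ᵥ u j)
  rw [hexp]
  have hterm : ∀ J : Fin k → Fin d, ‖f (fun i => (u (J i) ⬝ᵥ v i) • (M *ᵥ u (J i)))‖ ≤
      (d : ℝ) ^ k * (∏ i : Fin k, s (Fin.castLE hk i)) * ‖f‖ * ∏ i, ‖v i‖ := by
    intro J
    have hsm : f (fun i => (u (J i) ⬝ᵥ v i) • (M *ᵥ u (J i))) =
        (∏ i, (u (J i) ⬝ᵥ v i)) • f (fun i => (M *ᵥ u (J i))) :=
      f.toMultilinearMap.map_smul_univ _ _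
    rw [hsm]
    by_cases hJ : Function.Injective J
    · rw [norm_smul, norm_prod]
      have e1 : ∏ i, ‖u (J i) ⬝ᵥ v i‖ ≤ (d : ℝ) ^ k * ∏ i, ‖v i‖ := by
        calc _ ≤ ∏ i, ((d : ℝ) * ‖v i‖) := Finset.prod_le_prod (fun i _ => norm_nonneg _)
              fun i _ => abs_dot_le _ _ (h.abs_entry (J i))
          _ = _ := by rw [Finset.prod_mul_distrib]; simp
      have e2 : ‖f (fun i => (M *ᵥ u (J i)))‖ ≤ ‖f‖ * ∏ i : Fin k, s (Fin.castLE hk i) := by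
        refine (f.le_opNorm_mul_prod_of_le fun i => hMu (J i)).trans ?_
        exact mul_le_mul_of_nonneg_left (prod_inj_le hk s h.anti h.pos J hJ) (norm_nonneg _)
      calc _ ≤ ((d : ℝ) ^ k * ∏ i, ‖v i‖) * (‖f‖ * ∏ i : Fin k, s (Fin.castLE hk i)) :=
            mul_le_mul e1 e2 (norm_nonneg _) (by positivity)
        _ = _ := by ring
    · have : f (fun i => (M *ᵥ u (J i))) = 0 := by
        simp only [Function.Injective] at hJ
        push Not at hJ
        obtain ⟨a, b, hab, hne⟩ := hJ
        exact f.map_eq_zero_of_eq _ (by simp only [hab]) hne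
      rw [this, smul_zero, norm_zero]
      positivity
  refine (norm_sum_le _ _).trans ((Finset.sum_le_sum fun J _ => hterm J).trans (le_of_eq ?_))
  rw [Finset.sum_const, Finset.card_univ, Fintype.card_fun]
  simp only [Fintype.card_fin, nsmul_eq_mul]
  push_cast
  ring

lemma abs_det_le_rows {k : ℕ} (A : Matrix (Fin k) (Fin k) ℝ) (c : Fin k → ℝ)
    (h : ∀ i j, |A i j| ≤ c i) : |A.det| ≤ (k.factorial : ℝ) * ∏ i, c i := by
  rw [Matrix.det_apply]
  refine (Finset.abs_sum_le_sum_abs _ _).trans ?_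
  calc _ ≤ ∑ _σ : Equiv.Perm (Fin k), ∏ i, c i := by
        refine Finset.sum_le_sum fun σ _ => ?_
        rw [Units.smul_def, zsmul_eq_mul, abs_mul]
        have : |(((Equiv.Perm.sign σ : ℤˣ) : ℤ) : ℝ)| = 1 := by
          rcases Int.units_eq_one_or (Equiv.Perm.sign σ) with h | h <;> simp [h]
        rw [this, one_mul, Finset.abs_prod, ← Equiv.prod_comp σ c]
        exact Finset.prod_le_prod (fun i _ => abs_nonneg _) fun i _ => h _ _
    _ = _ := by simp [Fintype.card_perm]

lemma extN_lower {k d : ℕ} (hk : k ≤ d) {M u : Matrix (Fin d) (Fin d) ℝ} {s : Fin d → ℝ}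
    (h : SVData M u s) :
    ∏ i : Fin k, s (Fin.castLE hk i) ≤ ((k.factorial : ℝ) * (d : ℝ) ^ k) * extN k M := by
  let W : Matrix (Fin k) (Fin d) ℝ :=
    Matrix.of fun i => (s (Fin.castLE hk i))⁻¹ • (M *ᵥ u (Fin.castLE hk i))
  have hW : ∀ i a, |W i a| ≤ 1 := by
    intro i a
    have : ‖W i‖ ≤ 1 := by
      apply norm_le_of_dot _ _ zero_le_one
      have hp := h.pos (Fin.castLE hk i)
      change ((s (Fin.castLE hk i))⁻¹ • (M *ᵥ u (Fin.castLE hk i))) ⬝ᵥ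
        ((s (Fin.castLE hk i))⁻¹ • (M *ᵥ u (Fin.castLE hk i))) ≤ _
      rw [smul_dotProduct, dotProduct_smul, h.sv_dot, if_pos rfl]
      simp only [smul_eq_mul]
      apply le_of_eq
      field_simp
    exact (norm_le_pi_norm (W i) a).trans this
  let f0 : (Fin d → ℝ) [⋀^Fin k]→ₗ[ℝ] ℝ := Matrix.detRowAlternating.compLinearMap W.mulVecLin
  have hf0 : ∀ v, f0 v = Matrix.det (Matrix.of fun i => W *ᵥ v i) := fun v => rfl
  have hbound : ∀ v, ‖f0 v‖ ≤ ((k.factorial : ℝ) * (d : ℝ) ^ k) * ∏ i, ‖v i‖ := by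
    intro v
    rw [hf0]
    refine (abs_det_le_rows _ (fun i => d * ‖v i‖) fun i j => ?_).trans (le_of_eq ?_)
    · exact abs_dot_le _ _ (hW j)
    · rw [Finset.prod_mul_distrib]; simp; ring
  let f := f0.mkContinuous _ hbound
  have hfn : ‖f‖ ≤ ((k.factorial : ℝ) * (d : ℝ) ^ k) :=
    f0.mkContinuous_norm_le (by positivity) hbound
  let v : Fin k → Fin d → ℝ := fun i => u (Fin.castLE hk i)
  have hval : extPull k M f v = ∏ i : Fin k, s (Fin.castLE hk i) := by
    rw [extPull_apply]
    show f0 _ = _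
    rw [hf0]
    have : (Matrix.of fun i => W *ᵥ (M *ᵥ v i)) =
        diagonal fun i : Fin k => s (Fin.castLE hk i) := by
      ext i j
      simp only [Matrix.of_apply, Matrix.mulVec, W, v]
      change ((s (Fin.castLE hk j))⁻¹ • (M *ᵥ u (Fin.castLE hk j))) ⬝ᵥ
        (M *ᵥ u (Fin.castLE hk i)) = _
      rw [smul_dotProduct, h.sv_dot]
      have hp := h.pos (Fin.castLE hk j)
      by_cases hij : i = j
      · subst hij
        simp only [if_true, Matrix.diagonal_apply_eq, smul_eq_mul]
        field_simp
      · have : Fin.castLE hk j ≠ Fin.castLE hk i := fun e =>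
          hij ((Fin.castLE_injective hk) e).symm
        simp [this, hij]
    rw [this, Matrix.det_diagonal]
  have hv1 : ∀ i, ‖v i‖ ≤ 1 := fun i =>
    norm_le_of_dot _ _ zero_le_one (by simp only [v]; rw [h.row_dot, if_pos rfl]; norm_num)
  have hprod : ∏ i, ‖v i‖ ≤ 1 := Finset.prod_le_one (fun i _ => norm_nonneg _) fun i _ => hv1 i
  calc ∏ i : Fin k, s (Fin.castLE hk i) = extPull k M f v := hval.symm
    _ ≤ ‖extPull k M f v‖ := le_abs_self _
    _ ≤ ‖extPull k M f‖ * ∏ i, ‖v i‖ := (extPull k M f).le_opNorm v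
    _ ≤ ‖extPull k M f‖ * 1 := mul_le_mul_of_nonneg_left hprod (norm_nonneg _)
    _ ≤ extN k M * ‖f‖ := by rw [mul_one]; exact (extPull k M).le_opNorm f
    _ ≤ extN k M * ((k.factorial : ℝ) * (d : ℝ) ^ k) :=
      mul_le_mul_of_nonneg_left hfn (norm_nonneg (extPull k M))
    _ = _ := mul_comm _ _

lemma eNorm_sq {d : ℕ} (x : Fin d → ℝ) : eNorm x ^ 2 = x ⬝ᵥ x := by
  unfold eNorm
  rw [Real.sq_sqrt (Finset.sum_nonneg fun i _ => sq_nonneg _)]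
  simp [dotProduct, sq]

lemma eNorm_nonneg' {d : ℕ} (x : Fin d → ℝ) : 0 ≤ eNorm x := Real.sqrt_nonneg _

lemma eNorm_smul {d : ℕ} (c : ℝ) (hc : 0 ≤ c) (x : Fin d → ℝ) : eNorm (c • x) = c * eNorm x := by
  unfold eNorm
  simp only [Pi.smul_apply, smul_eq_mul, mul_pow, ← Finset.mul_sum]
  rw [Real.sqrt_mul (sq_nonneg c), Real.sqrt_sq hc]

lemma eNorm_mulVec_bound {d : ℕ} (M : Matrix (Fin d) (Fin d) ℝ) (x : Fin d → ℝ) :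
    eNorm (M *ᵥ x) ^ 2 ≤ (∑ i, ∑ j, M i j ^ 2) * eNorm x ^ 2 := by
  have h : ∀ y : Fin d → ℝ, eNorm y ^ 2 = ∑ i, y i ^ 2 := fun y =>
    Real.sq_sqrt (Finset.sum_nonneg fun i _ => sq_nonneg _)
  rw [h, h, Finset.sum_mul]
  exact Finset.sum_le_sum fun i _ => Finset.sum_mul_sq_le_sq_mul_sq Finset.univ (fun j => M i j) x

lemma opNorm_le_exp {d : ℕ} (M : Matrix (Fin d) (Fin d) ℝ) (x : Fin d → ℝ) :
    (M *ᵥ x) ⬝ᵥ (M *ᵥ x) ≤ Real.exp (max (Real.log (opNorm M)) 0) ^ 2 * (x ⬝ᵥ x) := by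
  have hbdd : BddAbove (Set.range fun x : {x : Fin d → ℝ // eNorm x ≤ 1} =>
      eNorm (M *ᵥ (x : Fin d → ℝ))) := by
    refine ⟨Real.sqrt (∑ i, ∑ j, M i j ^ 2), ?_⟩
    rintro _ ⟨⟨y, hy⟩, rfl⟩
    apply Real.le_sqrt_of_sq_le
    refine (eNorm_mulVec_bound M y).trans ?_
    refine mul_le_of_le_one_right
      (Finset.sum_nonneg fun i _ => Finset.sum_nonneg fun j _ => sq_nonneg _) ?_
    exact pow_le_one₀ (eNorm_nonneg' y) hy
  have h1 : eNorm (M *ᵥ x) ≤ opNorm M * eNorm x := by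
    rcases (eNorm_nonneg' x).eq_or_lt with h0 | h0
    · have := eNorm_mulVec_bound M x
      rw [← h0] at this ⊢
      have h2 : eNorm (M *ᵥ x) ^ 2 ≤ 0 := by simpa using this
      have h3 : eNorm (M *ᵥ x) = 0 := by
        have := sq_nonneg (eNorm (M *ᵥ x))
        exact pow_eq_zero_iff (two_ne_zero) |>.1 (le_antisymm h2 this)
      rw [h3]; simp
    · have hy : eNorm ((eNorm x)⁻¹ • x) ≤ 1 := by
        rw [eNorm_smul _ (inv_nonneg.2 h0.le), inv_mul_cancel₀ h0.ne']
      have := le_ciSup hbdd ⟨_, hy⟩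
      simp only at this
      rw [Matrix.mulVec_smul, eNorm_smul _ (inv_nonneg.2 h0.le), inv_mul_le_iff₀ h0] at this
      rw [mul_comm]; exact this
  have h2 : opNorm M ≤ Real.exp (max (Real.log (opNorm M)) 0) := by
    rcases le_or_gt (opNorm M) 0 with h | h
    · exact h.trans (Real.exp_pos _).le
    · calc opNorm M = Real.exp (Real.log (opNorm M)) := (Real.exp_log h).symm
        _ ≤ _ := Real.exp_le_exp.2 (le_max_left _ _)
  rw [← eNorm_sq, ← eNorm_sq, ← mul_pow]
  exact pow_le_pow_left₀ (eNorm_nonneg' _)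
    (h1.trans (mul_le_mul_of_nonneg_right h2 (eNorm_nonneg' _))) 2

lemma tendsto_div_of_bdd (a c : ℕ → ℝ) (C L : ℝ) (h : ∀ n, |c n - a n| ≤ C)
    (ha : Tendsto (fun n : ℕ => a n / n) atTop (𝓝 L)) :
    Tendsto (fun n : ℕ => c n / n) atTop (𝓝 L) := by
  have h0 : Tendsto (fun n : ℕ => (c n - a n) / n) atTop (𝓝 0) := by
    apply squeeze_zero_norm (a := fun n : ℕ => C / n) _ (tendsto_const_div_atTop_nhds_zero_nat C)
    intro n
    rw [norm_div, Real.norm_eq_abs, Real.norm_natCast]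
    exact div_le_div_of_nonneg_right (h n) (Nat.cast_nonneg n)
  have := ha.add h0
  rw [add_zero] at this
  refine this.congr fun n => by ring

/-- Abstract a.e. statement. -/
theorem MET_ae {d : ℕ} (hd : 1 ≤ d) {Ω : Type*} [MeasurableSpace Ω] (μ : Measure Ω)
    [IsProbabilityMeasure μ] (θ : Ω → Ω) (hθ : MeasurePreserving θ μ μ)
    (T : ℕ → Ω → Matrix (Fin d) (Fin d) ℝ) (hdet : ∀ n ω, IsUnit (T n ω).det)
    (hT0 : ∀ ω, T 0 ω = 1)
    (hT : ∀ m n ω, T (m + n) ω = T n (θ^[m] ω) * T m ω)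
    (hmeas : ∀ i j, Measurable fun ω => T 1 ω i j)
    (h₀ : Ω → ℝ) (hint : Integrable h₀ μ) (hpos : ∀ ω, 0 ≤ h₀ ω)
    (hup : ∀ ω x, (T 1 ω *ᵥ x) ⬝ᵥ (T 1 ω *ᵥ x) ≤ Real.exp (h₀ ω) ^ 2 * (x ⬝ᵥ x))
    (hlo : ∀ ω x, x ⬝ᵥ x ≤ Real.exp (h₀ ω) ^ 2 * ((T 1 ω *ᵥ x) ⬝ᵥ (T 1 ω *ᵥ x))) :
    ∀ᵐ ω ∂μ, ∃ Φ : Matrix (Fin d) (Fin d) ℝ, Φ.IsSymm ∧ Φ.PosDef ∧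
        ∃ R : ℕ → Matrix (Fin d) (Fin d) ℝ,
          (∀ n : ℕ, 1 ≤ n → (R n).IsSymm ∧ (R n).PosDef ∧
            R n ^ (2 * n) = (T n ω)ᵀ * T n ω) ∧ Tendsto R atTop (𝓝 Φ) := by
  have hd0 : (1 : ℝ) ≤ d := by exact_mod_cast hd
  obtain ⟨u, hu⟩ : ∃ u : ℕ → Ω → Matrix (Fin d) (Fin d) ℝ, ∀ n ω, ∃ s, SVData (T n ω) (u n ω) s :=
    ⟨fun n ω => (exists_SVData (T n ω) (hdet n ω)).choose,
      fun n ω => (exists_SVData (T n ω) (hdet n ω)).choose_spec⟩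
  choose s hsv using hu
  have hTm : ∀ n i j, Measurable fun ω => T n ω i j := by
    intro n
    induction n with
    | zero => intro i j; simp only [hT0]; exact measurable_const
    | succ n ih =>
      intro i j
      simp only [hT n 1, Matrix.mul_apply]
      exact Finset.measurable_fun_sum _ fun k _ =>
        ((hmeas i k).comp (hθ.measurable.iterate n)).mul (ih k j)
  have hEm : ∀ k n, Measurable fun ω => extN k (T n ω) := by
    intro k n
    have hc : Continuous fun M : Fin d → Fin d → ℝ => extN k (Matrix.of M) := extN_cont k d
    exact hc.measurable.comp
      (measurable_pi_lambda _ fun i => measurable_pi_lambda _ fun j => hTm n i j)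
  -- measurable version of h₀
  let h : Ω → ℝ := hint.aestronglyMeasurable.mk h₀
  have hhm : Measurable h := hint.aestronglyMeasurable.stronglyMeasurable_mk.measurable
  have hhe : h₀ =ᵐ[μ] h := hint.aestronglyMeasurable.ae_eq_mk
  have hhint : Integrable h μ := hint.congr hhe
  have horb : ∀ᵐ ω ∂μ, ∀ j : ℕ, h₀ (θ^[j] ω) = h (θ^[j] ω) :=
    ae_all_iff.2 fun j => (hθ.iterate j).quasiMeasurePreserving.ae hhe
  let S : ℕ → Ω → ℝ := fun n ω => ∑ j ∈ Finset.range n, h (θ^[j] ω)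
  have hSm : ∀ n, Measurable (S n) := fun n =>
    Finset.measurable_fun_sum _ fun j _ => hhm.comp (hθ.measurable.iterate j)
  have hSadd : ∀ m n ω, S (m + n) ω = S m ω + S n (θ^[m] ω) := by
    intro m n ω
    simp only [S, Finset.sum_range_add, ← Function.iterate_add_apply]
    congr 1
    exact Finset.sum_congr rfl fun j _ => by rw [add_comm]
  have hfinint : ∀ g : Ω → ℝ, Integrable g μ → ∫⁻ ω, ENNReal.ofReal (g ω) ∂μ ≠ ∞ := fun g hg =>
    hg.lintegral_lt_top.ne
  have K1 : ∀ᵐ ω ∂μ, ∃ L : ℝ, Tendsto (fun n : ℕ => S n ω / n) atTop (𝓝 L) := by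
    apply kingman_real θ hθ S hSm (fun m n ω => (hSadd m n ω).le)
    · apply hfinint
      simpa [S] using hhint
    · filter_upwards [horb] with ω hω n _
      exact Finset.sum_nonneg fun j _ => by rw [← hω j]; exact hpos _
  -- pointwise bounds on singular values
  have hstep : ∀ n ω x, (T n ω *ᵥ x) ⬝ᵥ (T n ω *ᵥ x) ≤
      Real.exp (h₀ (θ^[n] ω)) ^ 2 * ((T (n+1) ω *ᵥ x) ⬝ᵥ (T (n+1) ω *ᵥ x)) := by
    intro n ω x
    rw [hT n 1, ← Matrix.mulVec_mulVec]
    exact hlo _ _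
  have hstep' : ∀ n ω x, (T (n+1) ω *ᵥ x) ⬝ᵥ (T (n+1) ω *ᵥ x) ≤
      Real.exp (h₀ (θ^[n] ω)) ^ 2 * ((T n ω *ᵥ x) ⬝ᵥ (T n ω *ᵥ x)) := by
    intro n ω x
    rw [hT n 1, ← Matrix.mulVec_mulVec]
    exact hup _ _
  have hlowT : ∀ n ω x, x ⬝ᵥ x ≤ Real.exp (∑ j ∈ Finset.range n, h₀ (θ^[j] ω)) ^ 2 *
      ((T n ω *ᵥ x) ⬝ᵥ (T n ω *ᵥ x)) := by
    intro n
    induction n with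
    | zero => intro ω x; simp [hT0]
    | succ n ih =>
      intro ω x
      refine (ih ω x).trans ?_
      rw [Finset.sum_range_succ, Real.exp_add, mul_pow, mul_assoc]
      exact mul_le_mul_of_nonneg_left (hstep n ω x) (sq_nonneg _)
  have hslow : ∀ n ω i, Real.exp (-(∑ j ∈ Finset.range n, h₀ (θ^[j] ω))) ≤ s n ω i := by
    intro n ω i
    have h1 := hlowT n ω (u n ω i)
    rw [(hsv n ω).row_dot, (hsv n ω).sv_dot, if_pos rfl, if_pos rfl, ← mul_pow] at h1
    have hp := (hsv n ω).pos i
    have h2 : 1 ≤ Real.exp (∑ j ∈ Finset.range n, h₀ (θ^[j] ω)) * s n ω i := by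
      by_contra hc
      push Not at hc
      have := pow_lt_one₀ (by positivity) hc two_ne_zero
      linarith
    rw [Real.exp_neg, inv_le_iff_one_le_mul₀' (Real.exp_pos _)]
    exact h2
  have hsup : ∀ ω i, s 1 ω i ≤ Real.exp (h₀ ω) := by
    intro ω i
    have h1 := hup ω (u 1 ω i)
    rw [(hsv 1 ω).row_dot, (hsv 1 ω).sv_dot, if_pos rfl, if_pos rfl, mul_one] at h1
    exact le_of_sq_le_sq h1 (Real.exp_pos _).le
  -- products of singular values
  let P : (k : ℕ) → k ≤ d → ℕ → Ω → ℝ := fun k hk n ω => ∏ i : Fin k, s n ω (Fin.castLE hk i)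
  have hPpos : ∀ k hk n ω, 0 < P k hk n ω := fun k hk n ω =>
    Finset.prod_pos fun i _ => (hsv n ω).pos _
  have hPlow : ∀ k hk n ω, -(k * ∑ j ∈ Finset.range n, h₀ (θ^[j] ω)) ≤ Real.log (P k hk n ω) := by
    intro k hk n ω
    rw [Real.log_prod fun i _ => ((hsv n ω).pos _).ne']
    calc _ = ∑ _i : Fin k, (-(∑ j ∈ Finset.range n, h₀ (θ^[j] ω))) := by simp
      _ ≤ _ := Finset.sum_le_sum fun i _ => (Real.le_log_iff_exp_le ((hsv n ω).pos _)).2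
          (hslow n ω _)
  have hPup : ∀ k hk ω, Real.log (P k hk 1 ω) ≤ k * h₀ ω := by
    intro k hk ω
    rw [Real.log_prod fun i _ => ((hsv 1 ω).pos _).ne']
    calc _ ≤ ∑ _i : Fin k, h₀ ω := Finset.sum_le_sum fun i _ =>
          (Real.log_le_iff_le_exp ((hsv 1 ω).pos _)).2 (hsup ω _)
      _ = _ := by simp
  let c1 : ℕ → ℝ := fun k => (k.factorial : ℝ) * (d : ℝ) ^ k
  let c2 : ℕ → ℝ := fun k => (d : ℝ) ^ k * (d : ℝ) ^ k
  have hc1 : ∀ k, 1 ≤ c1 k := fun k => one_le_mul_of_one_le_of_one_le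
    (by exact_mod_cast Nat.one_le_iff_ne_zero.2 k.factorial_ne_zero) (one_le_pow₀ hd0)
  have hc2 : ∀ k, 1 ≤ c2 k := fun k => one_le_mul_of_one_le_of_one_le
    (one_le_pow₀ hd0) (one_le_pow₀ hd0)
  have hEpos : ∀ k, k ≤ d → ∀ n ω, 0 < extN k (T n ω) := by
    intro k hk n ω
    have h1 := (hPpos k hk n ω).trans_le (extN_lower hk (hsv n ω))
    exact pos_of_mul_pos_right h1 (zero_le_one.trans (hc1 k))
  have hElow : ∀ k hk n ω, Real.log (P k hk n ω) ≤ Real.log (c1 k) + Real.log (extN k (T n ω)) := by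
    intro k hk n ω
    rw [← Real.log_mul (by have := hc1 k; positivity) (hEpos k hk n ω).ne']
    exact Real.log_le_log (hPpos _ _ _ _) (extN_lower hk (hsv n ω))
  have hEup : ∀ k hk n ω, Real.log (extN k (T n ω)) ≤ Real.log (c2 k) + Real.log (P k hk n ω) := by
    intro k hk n ω
    rw [← Real.log_mul (by have := hc2 k; positivity) (hPpos k hk n ω).ne']
    exact Real.log_le_log (hEpos _ hk _ _) (extN_upper hk (hsv n ω))
  have K2 : ∀ k, k ≤ d → ∀ᵐ ω ∂μ, ∃ L : ℝ,
      Tendsto (fun n : ℕ => Real.log (extN k (T n ω)) / n) atTop (𝓝 L) := by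
    intro k hk
    let f : ℕ → Ω → ℝ := fun n ω => Real.log (extN k (T n ω)) + k * S n ω + n * Real.log (c1 k)
    have hf : ∀ᵐ ω ∂μ, ∃ L : ℝ, Tendsto (fun n : ℕ => f n ω / n) atTop (𝓝 L) := by
      apply kingman_real θ hθ f
      · intro n
        exact (((hEm k n).log).add ((hSm n).const_mul _)).add_const _
      · intro m n ω
        have h1 : Real.log (extN k (T (m + n) ω)) ≤
            Real.log (extN k (T m ω)) + Real.log (extN k (T n (θ^[m] ω))) := by
          rw [← Real.log_mul (hEpos k hk _ _).ne' (hEpos k hk _ _).ne', mul_comm]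
          apply Real.log_le_log (hEpos k hk _ _)
          rw [hT]
          exact extN_mul _ _ _
        simp only [f, hSadd]
        push_cast
        linarith
      · refine ne_top_of_le_ne_top (hfinint
          (fun ω => Real.log (c2 k) + Real.log (c1 k) + 2 * k * h ω) ?_) ?_
        · exact (integrable_const _).add (hhint.const_mul _)
        · apply lintegral_mono_ae
          filter_upwards [hhe] with ω hω
          apply ENNReal.ofReal_le_ofReal
          have h1 := hEup k hk 1 ω
          have h2 := hPup k hk ω
          rw [hω] at h2
          have h3 : S 1 ω = h ω := by simp [S]
          simp only [f, h3, Nat.cast_one]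
          linarith
      · filter_upwards [horb] with ω hω n hn
        have h1 := hElow k hk n ω
        have h2 := hPlow k hk n ω
        simp only [hω] at h2
        have h3 : (1 : ℝ) ≤ n := by exact_mod_cast hn
        have h4 : Real.log (c1 k) ≤ n * Real.log (c1 k) :=
          le_mul_of_one_le_left (Real.log_nonneg (hc1 k)) h3
        simp only [f, S]
        linarith
    filter_upwards [hf, K1] with ω ⟨L, hL⟩ ⟨L', hL'⟩
    refine ⟨L - k * L' - Real.log (c1 k), ?_⟩
    refine ((hL.sub (hL'.const_mul (k : ℝ))).sub_const (Real.log (c1 k))).congr' ?_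
    filter_upwards [eventually_ge_atTop 1] with n hn
    have hn0 : (n : ℝ) ≠ 0 := by positivity
    simp only [f]
    field_simp
    ring
  have K2' : ∀ᵐ ω ∂μ, ∀ k, k ≤ d → ∃ L : ℝ,
      Tendsto (fun n : ℕ => Real.log (extN k (T n ω)) / n) atTop (𝓝 L) := by
    rw [ae_all_iff]; intro k
    by_cases hk : k ≤ d
    · filter_upwards [K2 k hk] with ω hω _ using hω
    · exact Eventually.of_forall fun ω hk' => absurd hk' hk
  filter_upwards [K1, K2', horb] with ω ⟨L, hL⟩ hE hω
  have hP : ∀ k hk, ∃ L : ℝ, Tendsto (fun n : ℕ => Real.log (P k hk n ω) / n) atTop (𝓝 L) := by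
    intro k hk
    obtain ⟨L, hL⟩ := hE k hk
    refine ⟨L, tendsto_div_of_bdd _ _ (Real.log (c1 k) + Real.log (c2 k)) L (fun n => ?_) hL⟩
    have h1 := hElow k hk n ω
    have h2 := hEup k hk n ω
    have h3 := Real.log_nonneg (hc1 k)
    have h4 := Real.log_nonneg (hc2 k)
    rw [abs_le]
    constructor <;> linarith
  have hlam : ∀ i, ∃ l : ℝ, Tendsto (fun n : ℕ => Real.log (s n ω i) / n) atTop (𝓝 l) := by
    intro i
    obtain ⟨La, hLa⟩ := hP i i.2.le
    obtain ⟨Lb, hLb⟩ := hP (i + 1) i.2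
    refine ⟨Lb - La, (hLb.sub hLa).congr fun n => ?_⟩
    rw [← sub_div]
    congr 1
    have : P (i + 1) i.2 n ω = P i i.2.le n ω * s n ω i := by
      simp only [P, Fin.prod_univ_castSucc]
      rfl
    rw [this, Real.log_mul (hPpos _ _ _ _).ne' ((hsv n ω).pos i).ne']
    ring
  choose lam hlam using hlam
  refine det_MET (fun n => T n ω) (fun n => u n ω) (fun n => s n ω) (fun n => hsv n ω) lam hlam
    (fun n => h₀ (θ^[n] ω)) ?_ (fun n x => hstep' n ω x) (fun n x => hstep n ω x)
  have hsh := (tendsto_shift_div (fun n => S n ω) L hL).sub hL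
  rw [sub_self] at hsh
  refine hsh.congr fun n => ?_
  rw [hω, ← sub_div]
  congr 1
  simp [S, Finset.sum_range_succ]

/-- Multiplicative ergodic theorem for a discrete-time linear cocycle
`φ(n,ω) = A(θ^{n-1}ω) ⋯ A(ω)` over a measure-preserving bi-measurable bijection `θ`,
part (i): there is a `θ`-invariant full-measure set `Ω̃` such that for all `ω ∈ Ω̃`, the limit
`Φ(ω) = lim_{n→∞} (φ(n,ω)ᵀ φ(n,ω))^{1/(2n)}` exists and is a symmetric positive-definite
matrix.  The `(1/(2n))`-th power is encoded by a sequence `R n` of symmetric positive-definite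
matrices with `R n ^ (2n) = φ(n,ω)ᵀ φ(n,ω)` (such roots are unique). -/
theorem discrete_MET_limit_exists
    {d : ℕ} (hd : 1 ≤ d)
    {Ω : Type*} [MeasurableSpace Ω] (ℙ : Measure Ω) [IsProbabilityMeasure ℙ]
    (θ : Equiv.Perm Ω) (hθmeas : Measurable (θ : Ω → Ω))
    (hθinv : Measurable (θ.symm : Ω → Ω))
    (hθpres : MeasurePreserving (θ : Ω → Ω) ℙ ℙ)
    (A : Ω → GL (Fin d) ℝ)
    (hA : ∀ i j, Measurable fun ω => (A ω : Matrix (Fin d) (Fin d) ℝ) i j)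
    (φ : ℤ → Ω → GL (Fin d) ℝ)
    (hφ0 : ∀ ω, φ 0 ω = 1)
    (hφ1 : ∀ ω, φ 1 ω = A ω)
    (hφc : ∀ (m n : ℤ) (ω : Ω), φ (m + n) ω = φ m ((θ ^ n) ω) * φ n ω)
    (hint₁ : Integrable
      (fun ω => max (Real.log (opNorm (A ω : Matrix (Fin d) (Fin d) ℝ))) 0) ℙ)
    (hint₂ : Integrable
      (fun ω => max (Real.log (opNorm (((A ω)⁻¹ : GL (Fin d) ℝ) : Matrix (Fin d) (Fin d) ℝ))) 0)
      ℙ) :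
    ∃ Ω' : Set Ω, MeasurableSet Ω' ∧ ℙ Ω' = 1 ∧ (θ : Ω → Ω) ⁻¹' Ω' = Ω' ∧
      ∀ ω ∈ Ω', ∃ Φ : Matrix (Fin d) (Fin d) ℝ, Φ.IsSymm ∧ Φ.PosDef ∧
        ∃ R : ℕ → Matrix (Fin d) (Fin d) ℝ,
          (∀ n : ℕ, 1 ≤ n → (R n).IsSymm ∧ (R n).PosDef ∧
            R n ^ (2 * n) =
              ((φ (n : ℤ) ω : Matrix (Fin d) (Fin d) ℝ))ᵀ *
                ((φ (n : ℤ) ω : Matrix (Fin d) (Fin d) ℝ))) ∧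
          Tendsto R atTop (𝓝 Φ) := by
  let h₁ : Ω → ℝ := fun ω => max (Real.log (opNorm (A ω : Matrix (Fin d) (Fin d) ℝ))) 0
  let h₂ : Ω → ℝ := fun ω =>
    max (Real.log (opNorm (((A ω)⁻¹ : GL (Fin d) ℝ) : Matrix (Fin d) (Fin d) ℝ))) 0
  have hh1 : ∀ ω, 0 ≤ h₁ ω := fun ω => le_max_right _ _
  have hh2 : ∀ ω, 0 ≤ h₂ ω := fun ω => le_max_right _ _
  have hdotnn : ∀ x : Fin d → ℝ, 0 ≤ x ⬝ᵥ x := fun x =>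
    Finset.sum_nonneg fun i _ => mul_self_nonneg _
  have hae := MET_ae hd ℙ θ hθpres (fun n ω => (φ (n : ℤ) ω : Matrix (Fin d) (Fin d) ℝ))
    (fun n ω => (Matrix.isUnit_iff_isUnit_det _).1 (φ n ω).isUnit)
    (fun ω => by simp [hφ0])
    (fun m n ω => by
      have := hφc n m ω
      rw [add_comm] at this
      have e : (θ ^ (m : ℤ)) ω = θ^[m] ω := by
        rw [zpow_natCast, Equiv.Perm.iterate_eq_pow]
      rw [e] at this
      push_cast
      rw [this]; rfl)
    (fun i j => by simpa [hφ1] using hA i j)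
    (fun ω => h₁ ω + h₂ ω) (hint₁.add hint₂) (fun ω => add_nonneg (hh1 ω) (hh2 ω))
    (fun ω x => by
      simp only [Nat.cast_one, hφ1]
      refine (opNorm_le_exp _ x).trans (mul_le_mul_of_nonneg_right ?_ (hdotnn x))
      refine pow_le_pow_left₀ (Real.exp_pos _).le (Real.exp_le_exp.2 ?_) 2
      exact le_add_of_nonneg_right (hh2 ω))
    (fun ω x => by
      simp only [Nat.cast_one, hφ1]
      have hx : x = (((A ω)⁻¹ : GL (Fin d) ℝ) : Matrix (Fin d) (Fin d) ℝ) *ᵥ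
          ((A ω : Matrix (Fin d) (Fin d) ℝ) *ᵥ x) := by
        rw [Matrix.mulVec_mulVec, ← Units.val_mul, inv_mul_cancel, Units.val_one,
          Matrix.one_mulVec]
      conv_lhs => rw [hx]
      refine (opNorm_le_exp _ _).trans (mul_le_mul_of_nonneg_right ?_ (hdotnn _))
      refine pow_le_pow_left₀ (Real.exp_pos _).le (Real.exp_le_exp.2 ?_) 2
      exact le_add_of_nonneg_left (hh1 ω))
  obtain ⟨N, hN, hNm, hN0⟩ := exists_measurable_superset_of_null (mem_ae_iff.1 hae)
  have hsymm : MeasurePreserving (θ.symm : Ω → Ω) ℙ ℙ :=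
    MeasurePreserving.symm (⟨θ, hθmeas, hθinv⟩ : Ω ≃ᵐ Ω) hθpres
  have hz : ∀ z : ℤ, MeasurePreserving (fun ω => (θ ^ z) ω) ℙ ℙ := by
    intro z
    obtain ⟨n, rfl | rfl⟩ := z.eq_nat_or_neg
    · have h := hθpres.iterate n
      have e : (fun ω => (θ ^ (n : ℤ)) ω) = (θ : Ω → Ω)^[n] := by
        rw [zpow_natCast, Equiv.Perm.iterate_eq_pow]
      rw [e]; exact h
    · have h := hsymm.iterate n
      have e : (fun ω => (θ ^ (-(n : ℤ))) ω) = (θ.symm : Ω → Ω)^[n] := by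
        rw [_root_.zpow_neg, zpow_natCast, ← _root_.inv_pow, Equiv.Perm.iterate_eq_pow]; rfl
      rw [e]; exact h
  have hUm : MeasurableSet (⋃ z : ℤ, (fun ω => (θ ^ z) ω) ⁻¹' N) :=
    MeasurableSet.iUnion fun z => (hz z).measurable hNm
  refine ⟨(⋃ z : ℤ, (fun ω => (θ ^ z) ω) ⁻¹' N)ᶜ, hUm.compl, ?_, ?_, ?_⟩
  · rw [prob_compl_eq_one_iff hUm]
    exact measure_iUnion_null fun z => by
      rw [(hz z).measure_preimage hNm.nullMeasurableSet, hN0]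
  · rw [Set.preimage_compl]
    congr 1
    ext ω
    simp only [Set.mem_preimage, Set.mem_iUnion]
    constructor
    · rintro ⟨z, h⟩
      refine ⟨z + 1, ?_⟩
      rw [_root_.zpow_add_one]; exact h
    · rintro ⟨z, h⟩
      refine ⟨z - 1, ?_⟩
      have e : (θ ^ z) ω = (θ ^ (z - 1)) (θ ω) := by
        rw [← Equiv.Perm.mul_apply, ← _root_.zpow_add_one, sub_add_cancel]
      rw [← e]; exact h
  · intro ω hω
    by_contra hcon
    refine hω (Set.mem_iUnion.2 ⟨0, ?_⟩)
    exact hN hcon
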